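/- arXiv:1411.3065 — 3 statements merged into one kernel-verified Lean document; each statement's English description precedes it below -/
import Mathlib

section
/- Let h : {1,…,n} → {1,…,n} be any Hessenberg function. Then for every i with 1 ≤ i ≤ n, the polynomial e_i(x_1,…,x_n) − e_i(1,2,…,n)·t^i belongs to the ideal I(h) of ℚ[x_1,…,x_n,t], where e_i denotes the degree-i elementary symmetric polynomial (so e_i(1,2,…,n) ∈ ℚ is its value at (1,2,…,n)). -/
open MvPolynomial Finset

/-- The variable `t` in `ℚ[x_1,…,x_n,t]`, realized as `MvPolynomial (Option (Fin n)) ℚ`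
with `t = X none`. -/
noncomputable def tv (n : ℕ) : MvPolynomial (Option (Fin n)) ℚ := X none

/-- The variable `x_k` (for `1 ≤ k ≤ n`) in `ℚ[x_1,…,x_n,t]`. -/
noncomputable def xv (n : ℕ) (k : ℕ) : MvPolynomial (Option (Fin n)) ℚ :=
  if h : k - 1 < n then X (some ⟨k - 1, h⟩) else 0

/-- `p_i = ∑_{k=1}^i (x_k - k t)`, with `p_0 = 0`. -/
noncomputable def pp (n : ℕ) (i : ℕ) : MvPolynomial (Option (Fin n)) ℚ :=
  ∑ k ∈ Finset.range i, (xv n (k + 1) - C ((k : ℚ) + 1) * tv n)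

/-- The polynomials `f_{i,j}`: `f_{i,0} = 0`, `f_{j,j} = p_j`, and
`f_{i,j} = f_{i-1,j-1} + (x_j - x_i - t) f_{i-1,j}` for `i > j ≥ 1`. -/
noncomputable def ff (n : ℕ) : ℕ → ℕ → MvPolynomial (Option (Fin n)) ℚ
  | _, 0 => 0
  | 0, _ + 1 => 0
  | i + 1, j + 1 =>
      if i = j then pp n (j + 1)
      else ff n i j + (xv n (j + 1) - xv n (i + 1) - tv n) * ff n i (j + 1)


/-- The degree-`i` elementary symmetric polynomial `e_i(x_1,…,x_n)` in
`ℚ[x_1,…,x_n,t]`. -/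
noncomputable def esymmX (n : ℕ) (i : ℕ) : MvPolynomial (Option (Fin n)) ℚ :=
  ∑ A ∈ Finset.powersetCard i (Finset.univ : Finset (Fin n)), ∏ k ∈ A, X (some k)

/-- The rational number `e_i(1,2,…,n)`. -/
noncomputable def esymmVal (n : ℕ) (i : ℕ) : ℚ :=
  ∑ A ∈ Finset.powersetCard i (Finset.univ : Finset (Fin n)), ∏ k ∈ A, ((k : ℕ) + 1 : ℚ)


/-- Products `∏_{k ≤ m} (z - x_k)`. -/
noncomputable def BB (n m : ℕ) : Polynomial (MvPolynomial (Option (Fin n)) ℚ) :=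
  ∏ k ∈ Finset.range m, (Polynomial.X - Polynomial.C (xv n (k + 1)))

/-- Products `∏_{k ≤ m} (z - t - x_k)`. -/
noncomputable def BS (n m : ℕ) : Polynomial (MvPolynomial (Option (Fin n)) ℚ) :=
  ∏ k ∈ Finset.range m, (Polynomial.X - Polynomial.C (tv n) - Polynomial.C (xv n (k + 1)))

/-- Products `∏_{k ≤ m} (z - k t)`. -/
noncomputable def AA (n m : ℕ) : Polynomial (MvPolynomial (Option (Fin n)) ℚ) :=
  ∏ k ∈ Finset.range m, (Polynomial.X - Polynomial.C (C ((k : ℚ) + 1) * tv n))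

/-- Generating function of the `f_{m,j}`. -/
noncomputable def FF (n m : ℕ) : Polynomial (MvPolynomial (Option (Fin n)) ℚ) :=
  ∑ j ∈ Finset.range m, BB n j * Polynomial.C (ff n m (j + 1))

lemma ff_zero (n i : ℕ) : ff n i 0 = 0 := by cases i <;> simp [ff]

lemma ff_diag (n i : ℕ) : ff n i i = pp n i := by cases i <;> simp [ff, pp]

lemma ff_succ (n i j : ℕ) (h : i ≠ j) : ff n (i + 1) (j + 1) =
    ff n i j + (xv n (j + 1) - xv n (i + 1) - tv n) * ff n i (j + 1) := by
  rw [ff]; simp [h]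

lemma BB_succ (n m : ℕ) : BB n (m + 1) =
    BB n m * (Polynomial.X - Polynomial.C (xv n (m + 1))) := by
  simp [BB, Finset.prod_range_succ]

lemma BS_succ (n m : ℕ) : BS n (m + 1) =
    BS n m * (Polynomial.X - Polynomial.C (tv n) - Polynomial.C (xv n (m + 1))) := by
  simp [BS, Finset.prod_range_succ]

lemma FF_succ (n m : ℕ) : FF n (m + 1) =
    (Polynomial.X - Polynomial.C (tv n) - Polynomial.C (xv n (m + 1))) * FF n m +
      BB n m * (Polynomial.C (xv n (m + 1)) - Polynomial.C (C ((m : ℚ) + 1) * tv n)) := by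
  have h1 : ∑ j ∈ Finset.range (m + 1), BB n j * Polynomial.C (ff n m j) =
      ∑ j ∈ Finset.range m, BB n (j + 1) * Polynomial.C (ff n m (j + 1)) := by
    rw [Finset.sum_range_succ', ff_zero]; simp
  rw [Finset.sum_range_succ, ff_diag] at h1
  have h2 : ff n (m + 1) (m + 1) = pp n m + (xv n (m + 1) - C ((m : ℚ) + 1) * tv n) := by
    rw [ff_diag, pp, Finset.sum_range_succ, pp]
  have h3 : ∑ j ∈ Finset.range m, BB n j * Polynomial.C (ff n (m + 1) (j + 1)) =
      ∑ j ∈ Finset.range m, BB n j * Polynomial.C (ff n m j) +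
      ∑ j ∈ Finset.range m, BB n j * Polynomial.C
        ((xv n (j + 1) - xv n (m + 1) - tv n) * ff n m (j + 1)) := by
    rw [← Finset.sum_add_distrib]
    refine Finset.sum_congr rfl fun j hj => ?_
    rw [ff_succ n m j (by have := Finset.mem_range.1 hj; omega)]
    simp only [map_add]; ring
  have h4 : (Polynomial.X - Polynomial.C (tv n) - Polynomial.C (xv n (m + 1))) * FF n m =
      ∑ j ∈ Finset.range m, BB n (j + 1) * Polynomial.C (ff n m (j + 1)) +
      ∑ j ∈ Finset.range m, BB n j * Polynomial.C
        ((xv n (j + 1) - xv n (m + 1) - tv n) * ff n m (j + 1)) := by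
    rw [← Finset.sum_add_distrib, FF, Finset.mul_sum]
    refine Finset.sum_congr rfl fun j _ => ?_
    rw [BB_succ]
    simp only [map_mul, map_sub]; ring
  rw [h4, ← h1, FF, Finset.sum_range_succ, h3, h2]
  simp only [map_add, map_sub]; ring

lemma t_FF (n m : ℕ) : Polynomial.C (tv n) * FF n m =
    (Polynomial.X - Polynomial.C (C ((m : ℚ) + 1) * tv n)) * BB n m -
      (Polynomial.X - Polynomial.C (tv n)) * BS n m := by
  induction m with
  | zero => simp [FF, BB, BS]
  | succ m ih =>
    rw [FF_succ, mul_add, mul_left_comm, ih, BB_succ, BS_succ]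
    push_cast
    simp only [map_add, map_mul, map_one]; ring

lemma AA_succ_right (n m : ℕ) : (Polynomial.X - Polynomial.C (C ((m : ℚ) + 1) * tv n)) * AA n m =
    (Polynomial.X - Polynomial.C (tv n)) *
      (AA n m).comp (Polynomial.X - Polynomial.C (tv n)) := by
  have h1 : (Polynomial.X - Polynomial.C (C ((m : ℚ) + 1) * tv n)) * AA n m = AA n (m + 1) := by
    simp only [AA, Finset.prod_range_succ]; ring
  rw [h1, AA, Finset.prod_range_succ', AA, Polynomial.prod_comp, mul_comm]
  congr 1
  · simp
  · refine Finset.prod_congr rfl fun k _ => ?_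
    simp; ring

lemma BS_eq (n m : ℕ) : BS n m = (BB n m).comp (Polynomial.X - Polynomial.C (tv n)) := by
  simp [BS, BB, Polynomial.prod_comp]

/-- The images of `z^j` under the divided operator. -/
noncomputable def LL (n : ℕ) : ℕ → Polynomial (MvPolynomial (Option (Fin n)) ℚ)
  | 0 => Polynomial.C (C (-(n : ℚ)))
  | j + 1 => Polynomial.X * LL n j + (Polynomial.X - Polynomial.C (tv n)) ^ (j + 1)

lemma t_LL (n j : ℕ) : Polynomial.C (tv n) * LL n j =
    (Polynomial.X - Polynomial.C (C ((n : ℚ) + 1) * tv n)) * Polynomial.X ^ j -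
      (Polynomial.X - Polynomial.C (tv n)) * (Polynomial.X - Polynomial.C (tv n)) ^ j := by
  induction j with
  | zero => simp [LL]; ring
  | succ j ih =>
    rw [LL, mul_add, mul_left_comm, ih]; ring

lemma LL_deg (n j : ℕ) : (LL n j).natDegree ≤ j := by
  induction j with
  | zero => simp [LL]
  | succ j ih =>
    rw [LL]
    refine Polynomial.natDegree_add_le_of_degree_le ?_ ?_
    · refine Polynomial.natDegree_mul_le.trans ?_
      have := Polynomial.natDegree_X_le (R := MvPolynomial (Option (Fin n)) ℚ)
      omega
    · rw [Polynomial.natDegree_pow, Polynomial.natDegree_X_sub_C, mul_one]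

lemma LL_coeff (n j : ℕ) : (LL n j).coeff j = C ((j : ℚ) - n) := by
  induction j with
  | zero => simp [LL]
  | succ j ih =>
    have h := (Polynomial.monic_X_sub_C (tv n)).pow (j + 1)
    have h2 : ((Polynomial.X - Polynomial.C (tv n)) ^ (j + 1)).coeff (j + 1) = 1 := by
      have h3 := h.coeff_natDegree
      rwa [Polynomial.natDegree_pow, Polynomial.natDegree_X_sub_C, mul_one] at h3
    rw [LL, Polynomial.coeff_add, Polynomial.coeff_X_mul, ih, h2, ← map_one C, ← map_add]
    congr 1; push_cast; ring

lemma FF_eq (n : ℕ) (D : Polynomial (MvPolynomial (Option (Fin n)) ℚ))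
    (hD : D = BB n n - AA n n) (hdeg : D.natDegree < n) :
    FF n n = ∑ j ∈ Finset.range n, Polynomial.C (D.coeff j) * LL n j := by
  have ht : Polynomial.C (tv n) ≠ 0 := by
    rw [Ne, Polynomial.C_eq_zero]; exact MvPolynomial.X_ne_zero _
  apply mul_left_cancel₀ ht
  have e1 : D = ∑ j ∈ Finset.range n, Polynomial.C (D.coeff j) * Polynomial.X ^ j := by
    exact Polynomial.as_sum_range_C_mul_X_pow' D hdeg
  have e2 : D.comp (Polynomial.X - Polynomial.C (tv n)) = ∑ j ∈ Finset.range n,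
      Polynomial.C (D.coeff j) * (Polynomial.X - Polynomial.C (tv n)) ^ j := by
    conv_lhs => rw [e1]
    simp [Polynomial.sum_comp]
  have e3 : Polynomial.C (tv n) * FF n n =
    (Polynomial.X - Polynomial.C (C ((n : ℚ) + 1) * tv n)) * D -
      (Polynomial.X - Polynomial.C (tv n)) * D.comp (Polynomial.X - Polynomial.C (tv n)) := by
    rw [t_FF, BS_eq, hD, Polynomial.sub_comp, mul_sub, mul_sub, AA_succ_right]; ring
  rw [e3, e2]
  conv_lhs => enter [1]; rw [e1]
  rw [Finset.mul_sum, Finset.mul_sum, Finset.mul_sum, ← Finset.sum_sub_distrib]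
  refine Finset.sum_congr rfl fun j _ => ?_
  rw [mul_left_comm _ _ (LL n j), t_LL]; ring

lemma coeff_mem (n : ℕ) (I : Ideal (MvPolynomial (Option (Fin n)) ℚ))
    (d : ℕ → MvPolynomial (Option (Fin n)) ℚ)
    (hI : ∀ k, (∑ j ∈ Finset.range n, Polynomial.C (d j) * LL n j).coeff k ∈ I) :
    ∀ m k, k + m + 1 = n → d k ∈ I := by
  intro m
  induction m using Nat.strong_induction_on with
  | _ m ih =>
    intro k hk
    have h1 := hI k
    rw [Polynomial.finsetSum_coeff,
      ← Finset.add_sum_erase _ _ (Finset.mem_range.2 (show k < n by omega))] at h1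
    have h2 : ∑ j ∈ (Finset.range n).erase k, (Polynomial.C (d j) * LL n j).coeff k ∈ I := by
      refine Ideal.sum_mem _ fun j hj => ?_
      rw [Finset.mem_erase, Finset.mem_range] at hj
      rw [Polynomial.coeff_C_mul]
      rcases lt_or_gt_of_ne hj.1 with h | h
      · rw [Polynomial.coeff_eq_zero_of_natDegree_lt ((LL_deg n j).trans_lt h)]; simp
      · exact Ideal.mul_mem_right _ _ (ih (n - 1 - j) (by omega) j (by omega))
    have h3 := (Ideal.add_mem_iff_left I h2).1 h1
    rw [Polynomial.coeff_C_mul, LL_coeff] at h3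
    have h4 := Ideal.mul_mem_right (C (((k : ℚ) - n)⁻¹)) _ h3
    rw [mul_assoc, ← map_mul, mul_inv_cancel₀, map_one, mul_one] at h4
    · exact h4
    · have : (k : ℚ) < n := by exact_mod_cast (show k < n by omega)
      linarith

lemma coeff_prod (n i : ℕ) (hi : i ≤ n) {R : Type*} [CommRing R] (y : Fin n → R) :
    (∏ k : Fin n, (Polynomial.X - Polynomial.C (y k))).coeff (n - i) =
      (-1) ^ i * ∑ A ∈ Finset.powersetCard i (Finset.univ : Finset (Fin n)), ∏ k ∈ A, y k := by
  have h := Multiset.prod_X_sub_C_coeff (Finset.univ.val.map y) (k := n - i) (by simp)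
  rw [Multiset.map_map] at h
  simp only [Multiset.card_map, Finset.card_val, Finset.card_univ, Fintype.card_fin] at h
  rw [show n - (n - i) = i by omega, Finset.esymm_map_val] at h
  exact h

lemma BB_eq (n : ℕ) : BB n n = ∏ k : Fin n,
    (Polynomial.X - Polynomial.C (X (some k) : MvPolynomial (Option (Fin n)) ℚ)) := by
  rw [BB, Finset.prod_range]
  refine Finset.prod_congr rfl fun k _ => ?_
  simp [xv]

lemma AA_eq (n : ℕ) : AA n n = ∏ k : Fin n,
    (Polynomial.X - Polynomial.C (C (((k : ℕ) : ℚ) + 1) * tv n)) := by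
  rw [AA, Finset.prod_range]

lemma D_deg (n : ℕ) (hn : 1 ≤ n) : (BB n n - AA n n).natDegree < n := by
  have hB : (BB n n).Monic := Polynomial.monic_prod_X_sub_C _ _
  have hA : (AA n n).Monic := Polynomial.monic_prod_X_sub_C _ _
  have dB : (BB n n).natDegree = n := by
    rw [BB, Polynomial.natDegree_finsetProd_X_sub_C_eq_card]; simp
  have dA : (AA n n).natDegree = n := by
    rw [AA, Polynomial.natDegree_finsetProd_X_sub_C_eq_card]; simp
  have h := Polynomial.degree_sub_lt_left (p := BB n n) (q := AA n n)
    (by rw [Polynomial.degree_eq_natDegree hB.ne_zero, Polynomial.degree_eq_natDegree hA.ne_zero,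
      dA, dB]) hB.ne_zero (by rw [hB.leadingCoeff, hA.leadingCoeff])
  rw [Polynomial.degree_eq_natDegree hB.ne_zero, dB] at h
  by_cases h0 : BB n n - AA n n = 0
  · rw [h0, Polynomial.natDegree_zero]; exact hn
  · exact (Polynomial.natDegree_lt_iff_degree_lt h0).2 h

/-- For any Hessenberg function `h`, and any `1 ≤ i ≤ n`, the polynomial
`e_i(x_1,…,x_n) - e_i(1,2,…,n)·t^i` lies in the ideal `I(h)` generated by the
`f_{h(j),j}`, `1 ≤ j ≤ n`. -/
theorem stmt12 (n : ℕ) (h : ℕ → ℕ)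
    (hH1 : ∀ j : ℕ, 1 ≤ j → j ≤ n → j ≤ h j ∧ h j ≤ n)
    (hH2 : ∀ j : ℕ, 1 ≤ j → j < n → h j ≤ h (j + 1)) :
    ∀ i : ℕ, 1 ≤ i → i ≤ n →
      esymmX n i - C (esymmVal n i) * tv n ^ i ∈
        Ideal.span ((fun j => ff n (h j) j) '' Set.Icc 1 n) := by
  intro i hi hin
  set I := Ideal.span ((fun j => ff n (h j) j) '' Set.Icc 1 n) with hIdef
  -- all `f_{i,j}` with `i ≥ h j` lie in the ideal
  have key : ∀ j, 1 ≤ j → j ≤ n → ∀ i, h j ≤ i → ff n i j ∈ I := by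
    intro j hj
    induction j, hj using Nat.le_induction with
    | base =>
      intro hjn i hle
      induction i, hle using Nat.le_induction with
      | base => exact Ideal.subset_span ⟨1, ⟨le_refl _, hjn⟩, rfl⟩
      | succ i hle ih =>
        have := (hH1 1 le_rfl hjn).1
        rw [ff_succ n i 0 (by omega), ff_zero, zero_add]
        exact Ideal.mul_mem_left _ _ ih
    | succ j hj ihj =>
      intro hjn i hle
      induction i, hle using Nat.le_induction with
      | base => exact Ideal.subset_span ⟨j + 1, ⟨by omega, hjn⟩, rfl⟩
      | succ i hle ih =>
        have := (hH1 (j + 1) (by omega) hjn).1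
        have := hH2 j hj (by omega)
        rw [ff_succ n i j (by omega)]
        exact Ideal.add_mem _ (ihj (by omega) i (by omega)) (Ideal.mul_mem_left _ _ ih)
  have hF : FF n n ∈ I.map (Polynomial.C : _ →+* Polynomial (MvPolynomial (Option (Fin n)) ℚ)) := by
    refine Ideal.sum_mem _ fun j hj => Ideal.mul_mem_left _ _ (Ideal.mem_map_of_mem _ ?_)
    have hj := Finset.mem_range.1 hj
    exact key (j + 1) (by omega) (by omega) n (hH1 (j + 1) (by omega) (by omega)).2
  rw [Ideal.mem_map_C_iff, FF_eq n _ rfl (D_deg n (by omega))] at hF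
  have hm := coeff_mem n I _ hF (i - 1) (n - i) (by omega)
  rw [Polynomial.coeff_sub, BB_eq, AA_eq, coeff_prod n i hin, coeff_prod n i hin, ← mul_sub] at hm
  have hm2 := Ideal.mul_mem_left I ((-1) ^ i) hm
  rw [← mul_assoc, ← mul_pow] at hm2
  simp only [mul_neg, mul_one, neg_neg, one_pow, one_mul] at hm2
  suffices hs : C (esymmVal n i) * tv n ^ i =
      ∑ A ∈ Finset.powersetCard i (Finset.univ : Finset (Fin n)),
        ∏ k ∈ A, C (((k : ℕ) : ℚ) + 1) * tv n by
    rw [hs]; exact hm2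
  rw [esymmVal, map_sum, Finset.sum_mul]
  refine Finset.sum_congr rfl fun A hA => ?_
  rw [Finset.prod_mul_distrib, Finset.prod_const, (Finset.mem_powersetCard.1 hA).2, map_prod]
end

section
/- Let h : {1,…,n} → {1,…,n} be any Hessenberg function. Then the quotient ring ℚ[x_1,…,x_n,t]/I(h) is torsion-free as a module over ℚ[t]: for every g ∈ ℚ[x_1,…,x_n,t] and every nonzero c ∈ ℚ[t], if c·g ∈ I(h) then g ∈ I(h). -/
open MvPolynomial Finset

/-- Every syzygy of `f` is a Koszul syzygy. -/
def KS {R : Type*} [CommRing R] {ι : Type*} [Fintype ι] (f : ι → R) : Prop :=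
  ∀ a : ι → R, ∑ i, a i * f i = 0 →
    ∃ b : Matrix ι ι R, b.transpose = -b ∧ a = b.mulVec f

lemma KS_step {R : Type*} [CommRing R] [IsDomain R] [CharZero R] {ι : Type*} [Fintype ι]
    [DecidableEq ι] (f f' : ι → R) (j : ι) (w : ι → R) (hk : ∀ k, k ≠ j → f' k = f k)
    (hj : f' j = ∑ k, w k * f k) (hK : KS f') : KS f := by
  intro a ha
  set M : Matrix ι ι R := Matrix.updateRow 1 j w with hM
  have hMf : f' = M.mulVec f := by
    funext k
    by_cases h : k = j
    · subst h
      simp [hM, Matrix.mulVec, dotProduct, hj]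
    · simp [hM, Matrix.mulVec, dotProduct, hk k h, h, Matrix.updateRow_ne, Matrix.one_apply]
  have hsum : ∀ u : ι → R, ∑ i, u i * f' i = ∑ i, u i * f i + u j * (f' j - f j) := by
    intro u
    rw [← sub_eq_iff_eq_add', ← Finset.sum_sub_distrib, Finset.sum_eq_single j]
    · ring
    · intro b _ hb
      rw [hk b hb]; ring
    · simp
  obtain ⟨b, hb, hab⟩ := hK (fun i => (w j * a i - a j * w i) + if i = j then a j else 0) (by
    rw [hsum]
    simp only [add_mul, sub_mul, Finset.sum_add_distrib, Finset.sum_sub_distrib, mul_assoc,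
      ← Finset.mul_sum, ha, ← hj]
    simp
    ring)
  have hbjj : b j j = 0 := by
    have := congrFun (congrFun hb j) j
    simp only [Matrix.transpose_apply, Matrix.neg_apply] at this
    exact self_eq_neg.mp this
  have haj : a j = ∑ k, b j k * f k := by
    have h1 := congrFun hab j
    simp only [Matrix.mulVec, dotProduct, hsum, hbjj] at h1
    simp at h1
    rw [← h1]; ring
  set d : Matrix ι ι R := Matrix.of fun i k => (if i = j then b j k else 0) -
    (if k = j then b j i else 0) with hd
  have hdt : d.transpose = -d := by
    ext i k
    simp [hd]
  have hdf : ∀ i, d.mulVec f i = (if i = j then a j else 0) - b j i * f j := by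
    intro i
    simp only [hd, Matrix.mulVec, dotProduct, Matrix.of_apply, sub_mul, Finset.sum_sub_distrib]
    congr 1
    · split_ifs
      · rw [haj]
      · simp
    · simp
  set c : ι → R := fun i => a i - d.mulVec f i with hc
  have hcj : c j = 0 := by simp [hc, hdf, hbjj]
  obtain ⟨b', hb', hcb⟩ := hK c (by
    rw [hsum, hcj, zero_mul, add_zero]
    simp only [hc, hdf, sub_mul, Finset.sum_sub_distrib, ha]
    have : ∑ i, b j i * f j * f i = f j * ∑ i, b j i * f i := by
      rw [Finset.mul_sum]; exact Finset.sum_congr rfl fun i _ => by ring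
    rw [this, ← haj]
    simp; ring)
  have hMc : M.transpose.mulVec c = c := by
    funext k
    simp only [Matrix.mulVec, dotProduct, Matrix.transpose_apply]
    have : ∀ i, M i k * c i = (if i = k then c i else 0) := by
      intro i
      by_cases h : i = j
      · subst h; simp [hcj]
      · simp [hM, Matrix.updateRow_ne h, Matrix.one_apply]
    simp [this]
  refine ⟨M.transpose * b' * M + d, ?_, ?_⟩
  · simp only [Matrix.transpose_add, Matrix.transpose_mul, Matrix.transpose_transpose, hdt, hb']
    simp [Matrix.mul_assoc]
    abel
  · rw [Matrix.add_mulVec, ← Matrix.mulVec_mulVec, ← Matrix.mulVec_mulVec, ← hMf, ← hcb, hMc]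
    funext i
    simp [hc]

lemma KS_tri {R : Type*} [CommRing R] [IsDomain R] [CharZero R] {ι : Type*} [Fintype ι]
    [DecidableEq ι] (r : ι → ℕ) (hr : Function.Injective r) (f f' : ι → R)
    (hw : ∀ j, ∃ w : ι → R, f' j = ∑ k, w k * f k ∧ ∀ k, r j < r k → w k = 0)
    (hK : KS f') : KS f := by
  have key : ∀ m : ℕ, KS (fun j => if r j < m then f j else f' j) := by
    intro m
    induction m with
    | zero => simpa using hK
    | succ m ih =>
      by_cases hm : ∃ j, r j = m
      · obtain ⟨j, hj⟩ := hm
        obtain ⟨w, hw1, hw2⟩ := hw j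
        refine KS_step _ _ j w ?_ ?_ ih
        · intro k hk
          have : r k ≠ m := fun h => hk (hr (h.trans hj.symm))
          have h2 : (r k < m + 1) ↔ (r k < m) := by omega
          simp [h2]
        · simp only [hj, lt_irrefl, if_false, hw1]
          refine Finset.sum_congr rfl fun k _ => ?_
          by_cases h : r k < m + 1
          · simp [h]
          · rw [hw2 k (by omega)]; simp
      · have : (fun j => if r j < m + 1 then f j else f' j)
            = (fun j => if r j < m then f j else f' j) := by
          funext j
          have : r j ≠ m := fun h => hm ⟨j, h⟩
          have h2 : (r j < m + 1) ↔ (r j < m) := by omega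
          simp [h2]
        rw [this]; exact ih
  have := key (∑ j, r j + 1)
  have h2 : (fun j => if r j < ∑ j, r j + 1 then f j else f' j) = f := by
    funext j
    rw [if_pos]
    exact Nat.lt_succ_of_le (Finset.single_le_sum (f := r) (fun _ _ => Nat.zero_le _) (Finset.mem_univ j))
  rwa [h2] at this

lemma KS_cons {R : Type*} [CommRing R] {m : ℕ} (f : Fin m → R) (q : R) (hf : KS f)
    (hq : ∀ a, a * q ∈ Ideal.span (Set.range f) → a ∈ Ideal.span (Set.range f)) :
    KS (Fin.cons q f : Fin (m + 1) → R) := by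
  intro a ha
  rw [Fin.sum_univ_succ] at ha
  simp only [Fin.cons_zero, Fin.cons_succ] at ha
  have h0 : a 0 ∈ Ideal.span (Set.range f) := by
    apply hq
    rw [eq_neg_of_add_eq_zero_left ha]
    refine neg_mem (Ideal.sum_mem _ fun i _ => Ideal.mul_mem_left _ _ (Ideal.subset_span ⟨i, rfl⟩))
  obtain ⟨r, hr⟩ := (Ideal.mem_span_range_iff_exists_fun).1 h0
  obtain ⟨b, hb, hab⟩ := hf (fun i => a i.succ + r i * q) (by
    simp only [add_mul, Finset.sum_add_distrib]
    have : ∑ i, r i * q * f i = (∑ i, r i * f i) * q := by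
      rw [Finset.sum_mul]; exact Finset.sum_congr rfl fun i _ => by ring
    rw [this, hr, add_comm, ha])
  refine ⟨Matrix.of (Fin.cons (Fin.cons 0 r) fun i => Fin.cons (- r i) (b i)), ?_, ?_⟩
  · ext i k
    refine Fin.cases ?_ (fun i => ?_) i <;> refine Fin.cases ?_ (fun k => ?_) k
    · simp
    · simp
    · simp
    · simpa using congrFun (congrFun hb i) k
  · funext i
    refine Fin.cases ?_ (fun i => ?_) i
    · simp [Matrix.mulVec, dotProduct, Fin.sum_univ_succ, hr]
    · have := congrFun hab i
      simp only [Matrix.mulVec, dotProduct] at this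
      simp [Matrix.mulVec, dotProduct, Fin.sum_univ_succ, ← this]

lemma KS_C {S : Type*} [CommRing S] {m : ℕ} (f : Fin m → S) (hf : KS f) :
    KS (fun i => (Polynomial.C (f i) : Polynomial S)) := by
  intro a ha
  have h1 : ∀ N, ∃ b : Matrix (Fin m) (Fin m) S, b.transpose = -b ∧
      (fun i => (a i).coeff N) = b.mulVec f := by
    intro N
    apply hf
    have := congrArg (fun p => Polynomial.coeff p N) ha
    simpa [Polynomial.finsetSum_coeff] using this
  choose b hb hab using h1
  set D := ∑ i, (a i).natDegree + 1 with hD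
  refine ⟨Matrix.of fun i j => ∑ N ∈ Finset.range D, Polynomial.monomial N (b N i j), ?_, ?_⟩
  · ext i j : 1
    simp only [Matrix.transpose_apply, Matrix.neg_apply, Matrix.of_apply, ← Finset.sum_neg_distrib]
    refine Finset.sum_congr rfl fun N _ => ?_
    have := congrFun (congrFun (hb N) i) j
    simp only [Matrix.transpose_apply, Matrix.neg_apply] at this
    rw [this, Polynomial.monomial_neg]
  · funext i
    simp only [Matrix.mulVec, dotProduct, Matrix.of_apply, Finset.sum_mul,
      Polynomial.monomial_mul_C]
    rw [Finset.sum_comm]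
    have hdeg : (a i).natDegree < D := Nat.lt_succ_of_le
      (Finset.single_le_sum (f := fun i => (a i).natDegree) (fun _ _ => Nat.zero_le _) (Finset.mem_univ i))
    rw [(a i).as_sum_range' D hdeg]
    refine Finset.sum_congr rfl fun N _ => ?_
    have := congrFun (hab N) i
    simp only [Matrix.mulVec, dotProduct] at this
    rw [this, map_sum]

lemma KS_equiv {R R' : Type*} [CommRing R] [CommRing R'] {ι : Type*} [Fintype ι]
    (e : R ≃+* R') (f : ι → R) (f' : ι → R') (h : ∀ i, f' i = e (f i)) (hf : KS f) : KS f' := by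
  intro a ha
  obtain ⟨b, hb, hab⟩ := hf (fun i => e.symm (a i)) (by
    apply e.injective
    simpa [h] using ha)
  refine ⟨b.map e, ?_, ?_⟩
  · ext i j
    have := congrFun (congrFun hb i) j
    simp only [Matrix.transpose_apply, Matrix.neg_apply] at this
    simp [this]
  · funext i
    have := congrArg e (congrFun hab i)
    simpa [Matrix.mulVec, dotProduct, h] using this

lemma KS_cons_poly {S : Type*} [CommRing S] {m : ℕ} (f : Fin m → S) (hf : KS f)
    (q : Polynomial S) (hq : q.Monic) :
    KS (Fin.cons q (fun i => Polynomial.C (f i)) : Fin (m + 1) → Polynomial S) := by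
  refine KS_cons _ _ (KS_C f hf) ?_
  have hspan : Ideal.span (Set.range fun i => (Polynomial.C (f i) : Polynomial S))
      = (Ideal.span (Set.range f)).map Polynomial.C := by
    rw [Ideal.map_span, ← Set.range_comp]; rfl
  rw [hspan]
  intro a ha
  set L := Ideal.span (Set.range f)
  have hmem : ∀ p : Polynomial S, p ∈ L.map Polynomial.C ↔ p.map (Ideal.Quotient.mk L) = 0 := by
    intro p
    rw [Ideal.mem_map_C_iff, Polynomial.ext_iff]
    simp [Ideal.Quotient.eq_zero_iff_mem]
  rw [hmem] at ha ⊢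
  rw [Polynomial.map_mul] at ha
  exact ((hq.map (Ideal.Quotient.mk L)).mul_left_eq_zero_iff).1 ha

/-- base family -/
lemma KS_base {S : Type*} [CommRing S] [IsDomain S] (B : Polynomial S) (hB : B.Monic) (c : S)
    (hc : c ≠ 0) (m : ℕ) :
    KS (fun i : Fin (m + 1) => if h : (i : ℕ) < m then
      Polynomial.aeval (X ⟨i, h⟩ : MvPolynomial (Fin m) S) B else C c) := by
  induction m with
  | zero =>
    intro a ha
    simp at ha
    refine ⟨0, by simp, ?_⟩
    funext i
    have : i = (0 : Fin 1) := Subsingleton.elim (α := Fin 1) _ _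
    subst this
    simpa [hc] using ha
  | succ m ih =>
    have := KS_cons_poly _ ih (B.map (C : S →+* MvPolynomial (Fin m) S)) (hB.map _)
    refine KS_equiv (MvPolynomial.finSuccEquiv S m).symm.toRingEquiv _ _ ?_ this
    intro i
    apply (MvPolynomial.finSuccEquiv S m).injective
    refine Fin.cases ?_ (fun i => ?_) i
    · simp
      rw [← AlgEquiv.coe_toAlgHom, ← Polynomial.aeval_algHom_apply, AlgEquiv.coe_toAlgHom,
        MvPolynomial.finSuccEquiv_X_zero, Polynomial.aeval_def]
      rfl
    · by_cases h : (i : ℕ) < m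
      · simp [h]
        rw [← AlgEquiv.coe_toAlgHom, ← Polynomial.aeval_algHom_apply, AlgEquiv.coe_toAlgHom]
        have : (⟨(i : ℕ) + 1, by omega⟩ : Fin (m + 1)) = Fin.succ ⟨i, h⟩ := rfl
        rw [this, MvPolynomial.finSuccEquiv_X_succ]
        exact Polynomial.aeval_algebraMap_apply (Polynomial (MvPolynomial (Fin m) S)) _ B
      · simp [h]
        rw [MvPolynomial.finSuccEquiv_apply]; simp

lemma KS_tri' {R : Type*} [CommRing R] [IsDomain R] [CharZero R] {ι : Type*} [Fintype ι]
    [DecidableEq ι] (r : ι → ℕ) (hr : Function.Injective r) (f f' : ι → R)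
    (hw : ∀ j, f' j ∈ Ideal.span (f '' {k | r k ≤ r j}))
    (hK : KS f') : KS f := by
  refine KS_tri r hr f f' (fun j => ?_) hK
  have h1 : (f '' {k | r k ≤ r j}) = f '' ((Finset.univ.filter fun k => r k ≤ r j : Finset ι) : Set ι) := by
    simp
  have h2 := hw j
  rw [h1] at h2
  obtain ⟨w, hw⟩ := (Submodule.mem_span_image_finset_iff_exists_fun' R).1 h2
  refine ⟨fun k => if r k ≤ r j then w k else 0, ?_, ?_⟩
  · rw [← hw, Finset.sum_filter]
    exact Finset.sum_congr rfl fun k _ => by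
      by_cases hh : r k ≤ r j
      · simp only [hh, if_true, smul_eq_mul]
      · simp only [hh, if_false, zero_mul]
  · intro k hk
    simp [hk]

/-- The family `φ 1, …, φ n, c`. -/
def fam {R : Type*} (n : ℕ) (φ : ℕ → R) (c : R) : Fin (n + 1) → R :=
  fun i => if (i : ℕ) < n then φ (i + 1) else c

lemma KS_fwd {R : Type*} [CommRing R] [IsDomain R] [CharZero R] (n : ℕ) (φ φ' : ℕ → R) (c : R)
    (hw : ∀ j, 1 ≤ j → j ≤ n → φ' j ∈ Ideal.span (φ '' Set.Icc 1 j))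
    (hK : KS (fam n φ' c)) : KS (fam n φ c) := by
  refine KS_tri' (fun i : Fin (n + 1) => (i : ℕ)) Fin.val_injective _ _ (fun j => ?_) hK
  by_cases h : (j : ℕ) < n
  · simp only [fam, h, if_true]
    refine Ideal.span_mono ?_ (hw (j + 1) (by omega) (by omega))
    rintro _ ⟨k, ⟨hk1, hk2⟩, rfl⟩
    refine ⟨⟨k - 1, by omega⟩, by simp only [Set.mem_ofPred_eq]; omega, ?_⟩
    simp only [fam]
    rw [if_pos (by omega), Nat.sub_add_cancel hk1]
  · refine Ideal.subset_span ⟨j, by simp only [Set.mem_ofPred_eq, le_refl], by simp [fam, h]⟩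

lemma KS_bwd {R : Type*} [CommRing R] [IsDomain R] [CharZero R] (n : ℕ) (φ φ' : ℕ → R) (c : R)
    (hw : ∀ j, 1 ≤ j → j ≤ n → φ' j ∈ Ideal.span (φ '' Set.Icc j n))
    (hK : KS (fam n φ' c)) : KS (fam n φ c) := by
  refine KS_tri' (fun i : Fin (n + 1) => n - (i : ℕ)) ?_ _ _ (fun j => ?_) hK
  · intro a b hab
    have := a.2; have := b.2
    simp only at hab
    ext; omega
  by_cases h : (j : ℕ) < n
  · simp only [fam, h, if_true]
    refine Ideal.span_mono ?_ (hw (j + 1) (by omega) (by omega))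
    rintro _ ⟨k, ⟨hk1, hk2⟩, rfl⟩
    refine ⟨⟨k - 1, by omega⟩, by simp only [Set.mem_ofPred_eq]; omega, ?_⟩
    simp only [fam]
    rw [if_pos (by omega), Nat.sub_add_cancel (by omega)]
  · refine Ideal.subset_span ⟨j, by simp only [Set.mem_ofPred_eq, le_refl], by simp [fam, h]⟩

/-- Divided differences of `∏_{k=1}^i (z - k t)` at `x_1, …, x_j`. -/
noncomputable def gg (n : ℕ) : ℕ → ℕ → MvPolynomial (Option (Fin n)) ℚ
  | 0, j => if j = 1 then 1 else 0
  | _ + 1, 0 => 0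
  | i + 1, j + 1 => (xv n (j + 1) - ((i : MvPolynomial (Option (Fin n)) ℚ) + 1) * tv n) *
      gg n i (j + 1) + gg n i j

lemma gg_zero (n i : ℕ) : gg n i 0 = 0 := by cases i <;> simp [gg]

lemma gg_big (n i : ℕ) : ∀ j, i + 1 < j → gg n i j = 0 := by
  induction i with
  | zero => intro j hj; simp [gg]; omega
  | succ i ih =>
    intro j hj
    obtain ⟨j, rfl⟩ : ∃ k, j = k + 1 := ⟨j - 1, by omega⟩
    rw [gg, ih _ (by omega), ih _ (by omega)]; simp

lemma gg_diag (n i : ℕ) : gg n i (i + 1) = 1 := by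
  induction i with
  | zero => simp [gg]
  | succ i ih => rw [gg, ih, gg_big _ _ _ (by omega)]; simp

lemma ff_small (n i : ℕ) : ∀ j, i < j → ff n i j = 0 := by
  induction i with
  | zero => intro j hj; obtain ⟨j, rfl⟩ : ∃ k, j = k + 1 := ⟨j - 1, by omega⟩; simp [ff]
  | succ i ih =>
    intro j hj
    obtain ⟨j, rfl⟩ : ∃ k, j = k + 1 := ⟨j - 1, by omega⟩
    rw [ff, if_neg (by omega), ih _ (by omega), ih _ (by omega)]; simp

lemma ff_rec (n i j : ℕ) : ff n (i + 1) (j + 1) = ff n i j +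
    (xv n (j + 1) - xv n (i + 1) - tv n) * ff n i (j + 1) +
    if i = j then xv n (j + 1) - ((j : MvPolynomial (Option (Fin n)) ℚ) + 1) * tv n else 0 := by
  by_cases h : i = j
  · subst h
    rw [ff_diag, ff_diag, ff_small n i (i + 1) (by omega), pp, Finset.sum_range_succ, ← pp]
    simp
  · rw [ff]; simp [h]

lemma key_rel (n i : ℕ) : ∀ k, ∑ l ∈ Finset.range (i + 1), ff n l k * gg n i (l + 1) =
    ((i : MvPolynomial (Option (Fin n)) ℚ) + 1 - k) * gg n i k := by
  induction i with
  | zero =>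
    intro k
    rcases k with _ | _ | k <;> simp [gg, ff]
  | succ i ih =>
    intro k
    rcases k with _ | k
    · simp [ff_zero, gg_zero]
    have hterm : ∀ l, ff n l (k + 1) * gg n (i + 1) (l + 1) =
        (ff n l k * gg n i (l + 1) + (xv n (k + 1) - ((i : MvPolynomial (Option (Fin n)) ℚ) + 2) * tv n) *
          (ff n l (k + 1) * gg n i (l + 1))) +
        (if l = k then (xv n (k + 1) - ((k : MvPolynomial (Option (Fin n)) ℚ) + 1) * tv n) *
          gg n i (l + 1) else 0)
        - (ff n (l + 1) (k + 1) * gg n i (l + 1) - ff n l (k + 1) * gg n i l) := by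
      intro l
      rw [ff_rec, gg]
      split_ifs <;> ring
    have htel := Finset.sum_range_sub (fun l => ff n l (k + 1) * gg n i l) (i + 1 + 1)
    have hsplit : ∀ l, ff n (l + 1) (k + 1) * gg n (i) (l + 1) - ff n l (k + 1) * gg n i l =
      (fun l => ff n l (k + 1) * gg n i l) (l + 1) - (fun l => ff n l (k + 1) * gg n i l) l :=
      fun l => rfl
    rw [Finset.sum_congr rfl fun l _ => hterm l, Finset.sum_sub_distrib, Finset.sum_add_distrib,
      Finset.sum_add_distrib, ← Finset.mul_sum, htel, gg_big n i (i + 1 + 1) (by omega),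
      Finset.sum_range_succ, Finset.sum_range_succ _ (i + 1), ih, ih,
      gg_big n i (i + 1 + 1) (by omega), Finset.sum_ite_eq', gg_zero]
    have hδ : (if k ∈ Finset.range (i + 1 + 1) then
        (xv n (k + 1) - ((k : MvPolynomial (Option (Fin n)) ℚ) + 1) * tv n) * gg n i (k + 1) else 0)
        = (xv n (k + 1) - ((k : MvPolynomial (Option (Fin n)) ℚ) + 1) * tv n) * gg n i (k + 1) := by
      split_ifs with h
      · rfl
      · rw [gg_big n i (k + 1) (by simp at h; omega)]; simp
    rw [hδ, gg]
    push_cast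
    ring

lemma newton (n i : ℕ) (z : MvPolynomial (Option (Fin n)) ℚ) :
    ∏ k ∈ Finset.range i, (z - ((k : MvPolynomial (Option (Fin n)) ℚ) + 1) * tv n) =
    ∑ k ∈ Finset.range (i + 1), gg n i (k + 1) * ∏ l ∈ Finset.range k, (z - xv n (l + 1)) := by
  induction i with
  | zero => simp [gg]
  | succ i ih =>
    rw [Finset.prod_range_succ, ih]
    have hterm : ∀ k, gg n (i + 1) (k + 1) * ∏ l ∈ Finset.range k, (z - xv n (l + 1)) =
        (gg n i (k + 1) * ∏ l ∈ Finset.range k, (z - xv n (l + 1))) *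
          (z - ((i : MvPolynomial (Option (Fin n)) ℚ) + 1) * tv n) -
        (gg n i (k + 1) * ∏ l ∈ Finset.range (k + 1), (z - xv n (l + 1)) -
          gg n i k * ∏ l ∈ Finset.range k, (z - xv n (l + 1))) := by
      intro k
      rw [gg, Finset.prod_range_succ]; ring
    rw [Finset.sum_congr rfl fun k _ => hterm k, Finset.sum_sub_distrib,
      Finset.sum_range_sub (fun k => gg n i k * ∏ l ∈ Finset.range k, (z - xv n (l + 1))),
      gg_big n i (i + 1 + 1) (by omega), gg_zero, Finset.sum_range_succ _ (i + 1),
      gg_big n i (i + 1 + 1) (by omega), Finset.sum_mul]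
    simp

/-- `B(x_j)`. -/
noncomputable def bb (n j : ℕ) : MvPolynomial (Option (Fin n)) ℚ :=
  ∏ k ∈ Finset.range n, (xv n j - ((k : MvPolynomial (Option (Fin n)) ℚ) + 1) * tv n)

lemma bb_mem (n j : ℕ) (hj : 1 ≤ j) : bb n j ∈ Ideal.span (gg n n '' Set.Icc 1 j) := by
  rw [bb, newton]
  refine Ideal.sum_mem _ fun k _ => ?_
  by_cases h : k + 1 ≤ j
  · exact Ideal.mul_mem_right _ _ (Ideal.subset_span ⟨k + 1, ⟨by omega, h⟩, rfl⟩)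
  · have : ∏ l ∈ Finset.range k, (xv n j - xv n (l + 1)) = 0 :=
      Finset.prod_eq_zero (i := j - 1) (by simp; omega) (by rw [Nat.sub_add_cancel hj, sub_self])
    rw [this, mul_zero]; exact Ideal.zero_mem _

lemma gg_mem (n d : ℕ) : ∀ k, 1 ≤ k → k ≤ n → n - k = d →
    gg n n k ∈ Ideal.span (ff n n '' Set.Icc k n) := by
  induction d using Nat.strong_induction_on with
  | _ d ih =>
    intro k hk hkn hd
    have h := key_rel n n k
    have hmem : ((n : MvPolynomial (Option (Fin n)) ℚ) + 1 - k) * gg n n k ∈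
        Ideal.span (ff n n '' Set.Icc k n) := by
      rw [← h, Finset.sum_range_succ]
      refine Ideal.add_mem _ (Ideal.sum_mem _ fun l hl => ?_)
        (Ideal.mul_mem_right _ _ (Ideal.subset_span ⟨k, ⟨le_rfl, hkn⟩, rfl⟩))
      have hl := Finset.mem_range.1 hl
      by_cases hlk : l < k
      · rw [ff_small n l k hlk, zero_mul]; exact Ideal.zero_mem _
      · refine Ideal.mul_mem_left _ _ (Ideal.span_mono (Set.image_mono
          (Set.Icc_subset_Icc_left (show k ≤ l + 1 by omega))) (ih (n - (l + 1)) (by omega) (l + 1)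
            (by omega) (by omega) rfl))
    have hne : ((n : ℚ) + 1 - k) ≠ 0 := by
      have : (k : ℚ) ≤ n := by exact_mod_cast hkn
      linarith
    have := Ideal.mul_mem_left _ (C ((n : ℚ) + 1 - k)⁻¹) hmem
    have hC : ((n : MvPolynomial (Option (Fin n)) ℚ) + 1 - (k : MvPolynomial (Option (Fin n)) ℚ)) = C ((n : ℚ) + 1 - k) := by simp
    rwa [hC, ← mul_assoc, ← C_mul, inv_mul_cancel₀ hne, C_1, one_mul] at this

lemma ff_mem (n : ℕ) (h : ℕ → ℕ)
    (hH1 : ∀ j : ℕ, 1 ≤ j → j ≤ n → j ≤ h j ∧ h j ≤ n)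
    (hH2 : ∀ j : ℕ, 1 ≤ j → j < n → h j ≤ h (j + 1)) (i : ℕ) :
    ∀ j, 1 ≤ j → j ≤ n → h j ≤ i →
      ff n i j ∈ Ideal.span ((fun j => ff n (h j) j) '' Set.Icc 1 j) := by
  induction i with
  | zero => intro j h1 h2 h3; have := hH1 j h1 h2; omega
  | succ i ih =>
    intro j h1 h2 h3
    rcases h3.eq_or_lt with h3 | h3
    · exact Ideal.subset_span ⟨j, ⟨h1, le_rfl⟩, by simp [h3]⟩
    · have := hH1 j h1 h2
      obtain ⟨j, rfl⟩ : ∃ k, j = k + 1 := ⟨j - 1, by omega⟩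
      rw [ff, if_neg (by omega)]
      refine Ideal.add_mem _ ?_ (Ideal.mul_mem_left _ _ (ih _ h1 h2 (by omega)))
      rcases Nat.eq_zero_or_pos j with rfl | hj
      · rw [ff_zero]; exact Ideal.zero_mem _
      · have h5 := hH2 j hj (by omega)
        exact Ideal.span_mono (Set.image_mono (Set.Icc_subset_Icc_right (by omega)))
          (ih j hj (by omega) (by omega))

lemma KS_bb (n : ℕ) (c : Polynomial ℚ) (hc : c ≠ 0) :
    KS (fam n (bb n) (Polynomial.aeval (tv n) c)) := by
  have := KS_base (∏ k ∈ Finset.range n, (Polynomial.X - Polynomial.C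
    (((k : Polynomial ℚ) + 1) * Polynomial.X))) (Polynomial.monic_prod_X_sub_C _ _) c hc n
  refine KS_equiv (optionEquivRight ℚ (Fin n)).symm.toRingEquiv _ _ ?_ this
  intro i
  apply (optionEquivRight ℚ (Fin n)).injective
  by_cases h : (i : ℕ) < n
  · simp [fam, h, bb, xv, tv, optionEquivRight_X_some, optionEquivRight_X_none, map_prod]
  · simp [fam, h, tv, ← Polynomial.aeval_algHom_apply, optionEquivRight_X_none]


/-- For any Hessenberg function `h`, the quotient `ℚ[x_1,…,x_n,t]/I(h)` is torsion-free
as a `ℚ[t]`-module: if `c ∈ ℚ[t]` is nonzero (viewed in `ℚ[x_1,…,x_n,t]` via `t ↦ t`)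
and `c·g ∈ I(h)`, then `g ∈ I(h)`. -/
theorem stmt14 (n : ℕ) (h : ℕ → ℕ)
    (hH1 : ∀ j : ℕ, 1 ≤ j → j ≤ n → j ≤ h j ∧ h j ≤ n)
    (hH2 : ∀ j : ℕ, 1 ≤ j → j < n → h j ≤ h (j + 1)) :
    ∀ (g : MvPolynomial (Option (Fin n)) ℚ) (c : Polynomial ℚ), c ≠ 0 →
      Polynomial.aeval (tv n) c * g ∈ Ideal.span ((fun j => ff n (h j) j) '' Set.Icc 1 n) →
      g ∈ Ideal.span ((fun j => ff n (h j) j) '' Set.Icc 1 n) := by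
  intro g c hc hg
  have hK : KS (fam n (fun j => ff n (h j) j) (Polynomial.aeval (tv n) c)) :=
    KS_fwd n _ (ff n n) _ (fun j h1 h2 => ff_mem n h hH1 hH2 n j h1 h2 (hH1 j h1 h2).2)
      (KS_bwd n _ (gg n n) _ (fun j h1 h2 => gg_mem n _ j h1 h2 rfl)
        (KS_fwd n _ (bb n) _ (fun j h1 _ => bb_mem n j h1) (KS_bb n c hc)))
  set φ : ℕ → MvPolynomial (Option (Fin n)) ℚ := fun j => ff n (h j) j with hφ
  set c' := Polynomial.aeval (tv n) c with hc'
  have himg : φ '' Set.Icc 1 n = Set.range (fun i : Fin n => φ (i + 1)) := by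
    ext y
    constructor
    · rintro ⟨k, ⟨h1, h2⟩, rfl⟩
      exact ⟨⟨k - 1, by omega⟩, by simp [Nat.sub_add_cancel h1]⟩
    · rintro ⟨i, rfl⟩
      exact ⟨i + 1, ⟨by omega, i.2⟩, rfl⟩
  rw [himg] at hg ⊢
  obtain ⟨a, ha⟩ := Ideal.mem_span_range_iff_exists_fun.1 hg
  obtain ⟨b, hb, hab⟩ := hK (Fin.snoc (fun i => - a i) g) (by
    rw [Fin.sum_univ_castSucc]
    simp [fam, ha]
    ring)
  have hbn : b (Fin.last n) (Fin.last n) = 0 := by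
    have := congrFun (congrFun hb (Fin.last n)) (Fin.last n)
    simp only [Matrix.transpose_apply, Matrix.neg_apply] at this
    exact self_eq_neg.mp this
  have h1 := congrFun hab (Fin.last n)
  simp only [Fin.snoc_last, Matrix.mulVec, dotProduct, Fin.sum_univ_castSucc, hbn] at h1
  rw [h1, zero_mul, add_zero]
  refine Ideal.sum_mem _ fun i _ => Ideal.mul_mem_left _ _ (Ideal.subset_span ⟨i, ?_⟩)
  simp [fam]
end

section
/- Let h : {1,…,n} → {1,…,n} be any Hessenberg function and let Ǐ(h) ⊆ ℚ[x_1,…,x_n] be the ideal generated by f̌_{h(j),j} for j = 1,…,n. Then the quotient ℚ[x_1,…,x_n]/Ǐ(h) is a finite-dimensional ℚ-vector space of dimension ∏_{j=1}^{n} (h(j) − j + 1). -/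
open MvPolynomial Finset

/-- The variable `x_k` (for `1 ≤ k ≤ n`) in `ℚ[x_1,…,x_n]`. -/
noncomputable def xq (n : ℕ) (k : ℕ) : MvPolynomial (Fin n) ℚ :=
  if h : k - 1 < n then X (⟨k - 1, h⟩ : Fin n) else 0

/-- `f̌_{i,j} = ∑_{k=1}^{j} x_k ∏_{ℓ=j+1}^{i} (x_k - x_ℓ)`, the `t = 0` specialization of
`f_{i,j}` (the empty product is `1` when `i = j`). -/
noncomputable def fcheck (n : ℕ) (i j : ℕ) : MvPolynomial (Fin n) ℚ :=
  ∑ k ∈ Finset.Icc 1 j, xq n k * ∏ l ∈ Finset.Icc (j + 1) i, (xq n k - xq n l)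

namespace Hess15

/-- `u` is a nonzerodivisor modulo `J`. -/
def RegMod {R : Type*} [CommRing R] (J : Ideal R) (u : R) : Prop := ∀ g, u * g ∈ J → g ∈ J

/-- componentwise homogeneity of an ideal -/
def Hom {n : ℕ} (J : Ideal (MvPolynomial (Fin n) ℚ)) : Prop :=
  ∀ g ∈ J, ∀ i, homogeneousComponent i g ∈ J

theorem hom_span {n : ℕ} (s : Set (MvPolynomial (Fin n) ℚ))
    (hs : ∀ p ∈ s, ∃ d, p.IsHomogeneous d) : Hom (Ideal.span s) := by
  intro g hg i
  let _ : GradedAlgebra (homogeneousSubmodule (Fin n) ℚ) := gradedAlgebra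
  exact MvPolynomial.homogeneousComponent_mem_of_mem
    (Ideal.homogeneous_span (homogeneousSubmodule (Fin n) ℚ) s
      (fun x hx => (hs x hx))) hg i

theorem hc_mul {n d : ℕ} {b : MvPolynomial (Fin n) ℚ} (hb : b.IsHomogeneous d)
    (w : MvPolynomial (Fin n) ℚ) (i : ℕ) :
    homogeneousComponent i (b * w) = if d ≤ i then b * homogeneousComponent (i - d) w else 0 := by
  have h1 : b * w = ∑ j ∈ Finset.range (w.totalDegree + 1), b * homogeneousComponent j w := by
    rw [← Finset.mul_sum, sum_homogeneousComponent]
  rw [h1, map_sum]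
  have h2 : ∀ j, homogeneousComponent i (b * homogeneousComponent j w) =
      if d + j = i then b * homogeneousComponent j w else 0 := by
    intro j
    rw [homogeneousComponent_of_mem (m := i) (n := d + j)
      (hb.mul (homogeneousComponent_isHomogeneous j w))]
    simp only [eq_comm]
  simp only [h2]
  split_ifs with h
  · rw [Finset.sum_eq_single (i - d)]
    · simp [h]
    · intro j _ hj
      rw [if_neg]; omega
    · intro hj
      rw [if_pos (by omega), homogeneousComponent_eq_zero, mul_zero]
      simp at hj; omega
  · apply Finset.sum_eq_zero
    intro j _
    rw [if_neg]; omega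

/-- graded Nakayama -/
theorem nak {n d : ℕ} {J K : Ideal (MvPolynomial (Fin n) ℚ)} (hJ : Hom J)
    {u : MvPolynomial (Fin n) ℚ} (hu : u.IsHomogeneous d) (hd : 0 < d)
    (h : ∀ g ∈ K, ∃ j ∈ J, ∃ k ∈ K, g = j + u * k) : K ≤ J := by
  have key : ∀ i, ∀ g ∈ K, homogeneousComponent i g ∈ J := by
    intro i
    induction i using Nat.strong_induction_on with
    | _ i ih =>
      intro g hg
      obtain ⟨j, hj, k, hk, rfl⟩ := h g hg
      rw [map_add, hc_mul hu]
      refine J.add_mem (hJ _ hj _) ?_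
      split_ifs with hdi
      · exact J.mul_mem_left _ (ih _ (by omega) k hk)
      · exact J.zero_mem
  intro g hg
  rw [← sum_homogeneousComponent g]
  exact J.sum_mem fun i _ => key i g hg

theorem mem_sup_span {R : Type*} [CommRing R] {J : Ideal R} {u g : R} :
    g ∈ J ⊔ Ideal.span {u} ↔ ∃ j ∈ J, ∃ k, g = j + u * k := by
  rw [Submodule.mem_sup]
  constructor
  · rintro ⟨y, hy, z, hz, rfl⟩
    obtain ⟨k, rfl⟩ := Ideal.mem_span_singleton.1 hz
    exact ⟨y, hy, k, rfl⟩
  · rintro ⟨j, hj, k, rfl⟩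
    exact ⟨j, hj, _, Ideal.mem_span_singleton.2 (dvd_mul_right u k), rfl⟩

theorem swap1 {n d : ℕ} {J : Ideal (MvPolynomial (Fin n) ℚ)} (hJ : Hom J)
    {u v : MvPolynomial (Fin n) ℚ} (hu : u.IsHomogeneous d) (hd : 0 < d)
    (h1 : RegMod J u) (h2 : RegMod (J ⊔ Ideal.span {u}) v) :
    RegMod J v := by
  let K : Ideal (MvPolynomial (Fin n) ℚ) := Submodule.comap (LinearMap.mulLeft _ v) J
  have memK : ∀ g, g ∈ K ↔ v * g ∈ J := fun g => Iff.rfl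
  have : K ≤ J := by
    apply nak hJ hu hd
    intro g hg
    rw [memK] at hg
    obtain ⟨j, hj, k, rfl⟩ := mem_sup_span.1 (h2 g (Ideal.mem_sup_left hg))
    refine ⟨j, hj, k, ?_, rfl⟩
    rw [memK]
    apply h1
    have := J.sub_mem hg (J.mul_mem_left v hj)
    convert this using 1
    ring
  exact fun g hg => this hg

theorem swap2 {R : Type*} [CommRing R] {J : Ideal R}
    {u v : R} (h1 : RegMod J u) (h2 : RegMod (J ⊔ Ideal.span {u}) v) :
    RegMod (J ⊔ Ideal.span {v}) u := by
  intro g hg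
  obtain ⟨j, hj, w, hw⟩ := mem_sup_span.1 hg
  have h3 : w ∈ J ⊔ Ideal.span {u} := by
    apply h2
    refine mem_sup_span.2 ⟨-j, J.neg_mem hj, g, ?_⟩
    rw [hw]; ring
  obtain ⟨j', hj', w', rfl⟩ := mem_sup_span.1 h3
  refine mem_sup_span.2 ⟨g - v * w', ?_, w', by ring⟩
  apply h1
  have := J.add_mem hj (J.mul_mem_left v hj')
  convert this using 1
  rw [mul_sub, hw]; ring

theorem regMod_pow {R : Type*} [CommRing R] {J : Ideal R} {u : R} (h : RegMod J u) (N : ℕ) :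
    RegMod J (u ^ N) := by
  induction N with
  | zero => intro g hg; simpa using hg
  | succ N ih =>
    intro g hg
    apply h; apply ih
    rwa [← mul_assoc, ← pow_succ]

theorem exchange {R : Type*} [CommRing R] {J : Ideal R} {c b : R} (h : RegMod J c) (N : ℕ)
    (hN : c ^ N ∈ J ⊔ Ideal.span {b}) : RegMod J b := by
  intro g hg
  apply regMod_pow h N
  obtain ⟨j, hj, k, hk⟩ := mem_sup_span.1 hN
  rw [hk]
  have := J.add_mem (J.mul_mem_right g hj) (J.mul_mem_left k hg)
  convert this using 1
  ring

/-- polynomials of degree at most `m` -/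
noncomputable abbrev V (n m : ℕ) : Submodule ℚ (MvPolynomial (Fin n) ℚ) :=
  restrictTotalDegree (Fin n) ℚ m

/-- degree at most `m` part of an ideal -/
noncomputable abbrev W {n : ℕ} (m : ℕ) (J : Ideal (MvPolynomial (Fin n) ℚ)) :
    Submodule ℚ (MvPolynomial (Fin n) ℚ) := V n m ⊓ J.restrictScalars ℚ

theorem W_finite {n : ℕ} (m : ℕ) (J : Ideal (MvPolynomial (Fin n) ℚ)) :
    FiniteDimensional ℚ (W m J) :=
  Submodule.finiteDimensional_of_le (inf_le_left : W m J ≤ V n m)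

theorem mulLeft_inj {n : ℕ} {b : MvPolynomial (Fin n) ℚ} (hb : b ≠ 0) :
    Function.Injective (LinearMap.mulLeft ℚ b) := fun _ _ hxy => mul_left_cancel₀ hb hxy

theorem finrank_map_inj {A B : Type*} [AddCommGroup A] [AddCommGroup B] [Module ℚ A] [Module ℚ B]
    {f : A →ₗ[ℚ] B} (hf : Function.Injective f) (p : Submodule ℚ A) :
    Module.finrank ℚ (p.map f) = Module.finrank ℚ p :=
  (LinearEquiv.finrank_eq (Submodule.equivMapOfInjective f hf p)).symm

theorem W_eq {n d m : ℕ} {J : Ideal (MvPolynomial (Fin n) ℚ)} (hJ : Hom J)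
    {b : MvPolynomial (Fin n) ℚ} (hb : b.IsHomogeneous d) (hdm : d ≤ m) :
    W m (J ⊔ Ideal.span {b}) = W m J ⊔ (V n (m - d)).map (LinearMap.mulLeft ℚ b) := by
  apply le_antisymm
  · rintro g ⟨hg1, hg2⟩
    obtain ⟨j, hj, w, rfl⟩ := mem_sup_span.1 hg2
    have hdeg : (j + b * w).totalDegree ≤ m := (mem_restrictTotalDegree _ _ _).1 hg1
    have htr : ∑ i ∈ Finset.range (m + 1), homogeneousComponent i (j + b * w) = j + b * w := by
      conv_rhs => rw [← sum_homogeneousComponent (j + b * w)]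
      symm
      apply Finset.sum_subset
      · intro i; simp; omega
      · intro i _ hi
        apply homogeneousComponent_eq_zero
        simpa using hi
    rw [← htr]
    simp only [map_add, hc_mul hb, Finset.sum_add_distrib]
    refine Submodule.add_mem_sup ⟨?_, ?_⟩ ?_
    · apply Submodule.sum_mem
      intro i hi
      rw [mem_restrictTotalDegree]
      refine (homogeneousComponent_isHomogeneous i j).totalDegree_le.trans ?_
      simp at hi; omega
    · exact J.sum_mem fun i _ => hJ j hj i
    · apply Submodule.sum_mem
      intro i hi
      split_ifs with hdi
      · refine ⟨homogeneousComponent (i - d) w, ?_, rfl⟩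
        simp only [SetLike.mem_coe]
        rw [mem_restrictTotalDegree]
        refine (homogeneousComponent_isHomogeneous (i-d) w).totalDegree_le.trans ?_
        simp at hi; omega
      · exact Submodule.zero_mem _
  · apply sup_le
    · exact inf_le_inf le_rfl (fun g hg => Ideal.mem_sup_left hg)
    · rintro _ ⟨w, hw, rfl⟩
      simp only [SetLike.mem_coe] at hw
      rw [mem_restrictTotalDegree] at hw
      refine ⟨?_, ?_⟩
      · simp only [SetLike.mem_coe, LinearMap.mulLeft_apply]
        rw [mem_restrictTotalDegree]
        refine (totalDegree_mul _ _).trans ?_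
        have := hb.totalDegree_le
        omega
      · exact mem_sup_span.2 ⟨0, J.zero_mem, w, by simp⟩

theorem W_inf {n d m : ℕ} {J : Ideal (MvPolynomial (Fin n) ℚ)} 
    {b : MvPolynomial (Fin n) ℚ} (hb : b.IsHomogeneous d) (hreg : RegMod J b) (hdm : d ≤ m) :
    W m J ⊓ (V n (m - d)).map (LinearMap.mulLeft ℚ b) =
      (W (m - d) J).map (LinearMap.mulLeft ℚ b) := by
  apply le_antisymm
  · rintro _ ⟨⟨_, h2⟩, ⟨w, hw, rfl⟩⟩
    exact ⟨w, ⟨hw, hreg _ h2⟩, rfl⟩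
  · rintro _ ⟨w, ⟨hw, hwJ⟩, rfl⟩
    refine ⟨⟨?_, J.mul_mem_left b hwJ⟩, ⟨w, hw, rfl⟩⟩
    simp only [SetLike.mem_coe, LinearMap.mulLeft_apply] at hw ⊢
    rw [mem_restrictTotalDegree] at hw ⊢
    refine (totalDegree_mul _ _).trans ?_
    have := hb.totalDegree_le
    omega

theorem W_rank {n d m : ℕ} {J : Ideal (MvPolynomial (Fin n) ℚ)} (hJ : Hom J)
    {b : MvPolynomial (Fin n) ℚ} (hb : b.IsHomogeneous d) (hb0 : b ≠ 0)
    (hreg : RegMod J b) (hdm : d ≤ m) :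
    Module.finrank ℚ (W m (J ⊔ Ideal.span {b})) + Module.finrank ℚ (W (m - d) J) =
      Module.finrank ℚ (W m J) + Module.finrank ℚ (V n (m - d)) := by
  have := W_finite m J
  have h := Submodule.finrank_sup_add_finrank_inf_eq (W m J)
    ((V n (m - d)).map (LinearMap.mulLeft ℚ b))
  rw [← W_eq hJ hb hdm, W_inf hb hreg hdm] at h
  rwa [finrank_map_inj (mulLeft_inj hb0), finrank_map_inj (mulLeft_inj hb0)] at h

theorem quot_rank {n : ℕ} (I : Ideal (MvPolynomial (Fin n) ℚ))
    [FiniteDimensional ℚ (MvPolynomial (Fin n) ℚ ⧸ I)] :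
    ∃ M, ∀ m, M ≤ m → Module.finrank ℚ (MvPolynomial (Fin n) ℚ ⧸ I) + 
      Module.finrank ℚ (W m I) = Module.finrank ℚ (V n m) := by
  obtain ⟨s, hs⟩ := Module.Finite.fg_top (R := ℚ) (M := MvPolynomial (Fin n) ℚ ⧸ I)
  let σ := Function.surjInv (Ideal.Quotient.mk_surjective (I := I))
  refine ⟨s.sup fun q => (σ q).totalDegree, fun m hm => ?_⟩
  let φ : V n m →ₗ[ℚ] (MvPolynomial (Fin n) ℚ ⧸ I) :=
    (Ideal.Quotient.mkₐ ℚ I).toLinearMap.comp (V n m).subtype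
  have hφ : LinearMap.range φ = ⊤ := by
    rw [eq_top_iff, ← hs, Submodule.span_le]
    intro q hq
    refine ⟨⟨σ q, ?_⟩, Function.surjInv_eq Ideal.Quotient.mk_surjective q⟩
    rw [mem_restrictTotalDegree]
    exact (Finset.le_sup (f := fun q => (σ q).totalDegree) hq).trans hm
  have h := LinearMap.finrank_range_add_finrank_ker φ
  rw [hφ, finrank_top] at h
  rw [← h]
  congr 1
  have hk : W m I = (LinearMap.ker φ).map (V n m).subtype := by
    ext g
    simp only [Submodule.mem_map, LinearMap.mem_ker, Submodule.mem_inf]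
    constructor
    · rintro ⟨h1, h2⟩
      exact ⟨⟨g, h1⟩, Ideal.Quotient.eq_zero_iff_mem.2 h2, rfl⟩
    · rintro ⟨⟨g, h1⟩, h2, rfl⟩
      exact ⟨h1, Ideal.Quotient.eq_zero_iff_mem.1 h2⟩
  rw [hk]
  exact finrank_map_inj (V n m).injective_subtype _

theorem dim_exchange {n d : ℕ} {J : Ideal (MvPolynomial (Fin n) ℚ)} (hJ : Hom J)
    {b c : MvPolynomial (Fin n) ℚ} (hb : b.IsHomogeneous d) (hregb : RegMod J b)
    (hc : c.IsHomogeneous 1) (hregc : RegMod J c)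
    [FiniteDimensional ℚ (MvPolynomial (Fin n) ℚ ⧸ (J ⊔ Ideal.span {b}))]
    [FiniteDimensional ℚ (MvPolynomial (Fin n) ℚ ⧸ (J ⊔ Ideal.span {c}))] :
    Module.finrank ℚ (MvPolynomial (Fin n) ℚ ⧸ (J ⊔ Ideal.span {b})) =
      d * Module.finrank ℚ (MvPolynomial (Fin n) ℚ ⧸ (J ⊔ Ideal.span {c})) := by
  by_cases hJt : J = ⊤
  · subst hJt
    have z : ∀ u : MvPolynomial (Fin n) ℚ,
        Module.finrank ℚ (MvPolynomial (Fin n) ℚ ⧸ ((⊤ : Ideal (MvPolynomial (Fin n) ℚ)) ⊔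
          Ideal.span {u})) = 0 := by
      intro u
      have : Subsingleton (MvPolynomial (Fin n) ℚ ⧸
          ((⊤ : Ideal (MvPolynomial (Fin n) ℚ)) ⊔ Ideal.span {u})) :=
        Ideal.Quotient.subsingleton_iff.2 (by simp)
      exact Module.finrank_zero_of_subsingleton
    rw [z, z, mul_zero]
  have nz : ∀ u, RegMod J u → u ≠ 0 := by
    rintro u hu rfl
    exact hJt ((Ideal.eq_top_iff_one _).2 (hu 1 (by simp)))
  have hb0 := nz b hregb
  have hc0 := nz c hregc
  obtain ⟨M1, h1⟩ := quot_rank (J ⊔ Ideal.span {b})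
  obtain ⟨M2, h2⟩ := quot_rank (J ⊔ Ideal.span {c})
  set A := Module.finrank ℚ (MvPolynomial (Fin n) ℚ ⧸ (J ⊔ Ideal.span {b}))
  set B := Module.finrank ℚ (MvPolynomial (Fin n) ℚ ⧸ (J ⊔ Ideal.span {c}))
  let F : ℕ → ℤ := fun m => (Module.finrank ℚ (V n m) : ℤ) - Module.finrank ℚ (W m J)
  have hB : ∀ m, M2 ≤ m → F (m + 1) = F m + B := by
    intro m hm
    have e1 := h2 (m + 1) (by omega)
    have e2 := W_rank hJ hc hc0 hregc (m := m + 1) (by omega)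
    rw [Nat.add_sub_cancel] at e2
    simp only [F]
    omega
  have hB' : ∀ k, F (M1 + M2 + k) = F (M1 + M2) + k * B := by
    intro k
    induction k with
    | zero => simp
    | succ k ih => rw [← add_assoc, hB _ (by omega), ih]; push_cast; ring
  have hA : F (M1 + M2 + d) = F (M1 + M2) + A := by
    have e1 := h1 (M1 + M2 + d) (by omega)
    have e2 := W_rank hJ hb hb0 hregb (m := M1 + M2 + d) (by omega)
    rw [Nat.add_sub_cancel] at e2
    simp only [F]
    omega
  have := hB' d
  rw [hA] at this
  have h3 : (A : ℤ) = d * B := by linarith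
  exact_mod_cast h3

theorem xq_fin {n : ℕ} (i : Fin n) : xq n (i + 1) = X i := by
  simp [xq]

theorem xq_eq {n k : ℕ} (hk : k < n) : xq n (k + 1) = X ⟨k, hk⟩ := by
  simp [xq, hk]

theorem xq_hom (n k : ℕ) : (xq n k).IsHomogeneous 1 := by
  unfold xq
  split_ifs
  · exact isHomogeneous_X _ _
  · exact isHomogeneous_zero _ _ _

theorem fcheck_hom (n i j : ℕ) : (fcheck n i j).IsHomogeneous (i - j + 1) := by
  unfold fcheck
  apply IsHomogeneous.sum
  intro k _
  have h1 : (∏ l ∈ Finset.Icc (j + 1) i, (xq n k - xq n l)).IsHomogeneous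
      (∑ l ∈ Finset.Icc (j + 1) i, 1) :=
    IsHomogeneous.prod _ _ _ fun l _ => (xq_hom n k).sub (xq_hom n l)
  have h2 := (xq_hom n k).mul h1
  convert h2 using 1
  simp; omega

theorem fcheck_rec (n i j : ℕ) (hij : j + 1 ≤ i) :
    fcheck n (i + 1) (j + 1) =
      fcheck n i j + (xq n (j + 1) - xq n (i + 1)) * fcheck n i (j + 1) := by
  have h0 : fcheck n i j = ∑ k ∈ Finset.Icc 1 (j + 1),
      xq n k * ((xq n k - xq n (j + 1)) * ∏ l ∈ Finset.Icc (j + 2) i, (xq n k - xq n l)) := by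
    have hb : Finset.Icc (j + 1) i = insert (j + 1) (Finset.Icc (j + 2) i) := by
      ext a; simp; omega
    unfold fcheck
    rw [Finset.sum_Icc_succ_top (by omega), hb]
    simp only [sub_self, zero_mul, mul_zero, add_zero]
    apply Finset.sum_congr rfl
    intro k _
    rw [Finset.prod_insert (by simp)]
  rw [h0]
  unfold fcheck
  rw [Finset.mul_sum, ← Finset.sum_add_distrib]
  apply Finset.sum_congr rfl
  intro k _
  rw [Finset.prod_Icc_succ_top (by omega)]
  ring

/-- The ideal `⟨x_1, …, x_r, f_{h(i+1),i+1}, …, f_{h(n),n}⟩`. -/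
noncomputable def Id (n : ℕ) (h : ℕ → ℕ) (r i : ℕ) : Ideal (MvPolynomial (Fin n) ℚ) :=
  Ideal.span ((xq n '' Set.Icc 1 r) ∪ ((fun j => fcheck n (h j) j) '' Set.Icc (i + 1) n))

theorem Id_hom (n : ℕ) (h : ℕ → ℕ) (r i : ℕ) : Hom (Id n h r i) := by
  apply hom_span
  rintro p (⟨k, _, rfl⟩ | ⟨k, _, rfl⟩)
  · exact ⟨1, xq_hom n k⟩
  · exact ⟨_, fcheck_hom n _ k⟩

theorem Id_r (n : ℕ) (h : ℕ → ℕ) (r i : ℕ) :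
    Id n h (r + 1) i = Id n h r i ⊔ Ideal.span {xq n (r + 1)} := by
  have : Set.Icc 1 (r + 1) = insert (r + 1) (Set.Icc 1 r) := by
    ext a; simp; omega
  unfold Id
  rw [this, Set.image_insert_eq, Set.insert_union, Ideal.span_insert, sup_comm]

theorem Id_i (n : ℕ) (h : ℕ → ℕ) (r i : ℕ) (hi : i + 1 ≤ n) :
    Id n h r i = Id n h r (i + 1) ⊔ Ideal.span {fcheck n (h (i + 1)) (i + 1)} := by
  have : Set.Icc (i + 1) n = insert (i + 1) (Set.Icc (i + 1 + 1) n) := by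
    ext a; simp; omega
  unfold Id
  rw [this, Set.image_insert_eq, Set.union_insert, Ideal.span_insert, sup_comm]

theorem f_mem (n : ℕ) (h : ℕ → ℕ)
    (hH1 : ∀ j : ℕ, 1 ≤ j → j ≤ n → j ≤ h j ∧ h j ≤ n)
    (hH2 : ∀ j : ℕ, 1 ≤ j → j < n → h j ≤ h (j + 1)) (i m j : ℕ) (hjn : j ≤ n)
    (hm : 1 ≤ j → h j ≤ m) : fcheck n m j ∈ Id n h i i := by
  induction m generalizing j with
  | zero =>
    have : j = 0 := by
      by_contra h0
      have := hH1 j (by omega) hjn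
      have := hm (by omega)
      omega
    subst this
    simp [fcheck]
  | succ m ih =>
    by_cases hji : j ≤ i
    · unfold fcheck
      apply Ideal.sum_mem
      intro k hk
      apply Ideal.mul_mem_right
      apply Ideal.subset_span
      left
      refine ⟨k, ?_, rfl⟩
      simp at hk ⊢; omega
    · by_cases hmj : h j = m + 1
      · rw [← hmj]
        apply Ideal.subset_span
        right
        exact ⟨j, by simp; omega, rfl⟩
      · obtain ⟨j, rfl⟩ : ∃ j', j = j' + 1 := ⟨j - 1, by omega⟩
        have h1 := hH1 (j + 1) (by omega) hjn
        have h2 := hm (by omega)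
        rw [fcheck_rec n m j (by omega)]
        apply Ideal.add_mem
        · apply ih j (by omega)
          intro hj
          have := hH2 j hj (by omega)
          omega
        · apply Ideal.mul_mem_left
          apply ih (j + 1) hjn
          intro _; omega

theorem Q_mem (n : ℕ) (I : Ideal (MvPolynomial (Fin n) ℚ))
    (hI : ∀ j ≤ n, fcheck n n j ∈ I) (s j : ℕ) (hsj : s ≤ j) (hj : j ≤ n) :
    ∑ k ∈ Finset.Icc 1 n, xq n k ^ (s + 1) * ∏ l ∈ Finset.Icc (j + 1) n, (xq n k - xq n l) ∈ I := by
  induction s generalizing j with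
  | zero =>
    convert hI j hj using 1
    unfold fcheck
    symm
    simp only [zero_add, pow_one]
    apply Finset.sum_subset
    · intro a; simp; omega
    · intro k hk hk'
      rw [Finset.prod_eq_zero (i := k)]
      · simp
      · simp at hk hk' ⊢; omega
      · simp
  | succ s ih =>
    obtain ⟨j, rfl⟩ : ∃ j', j = j' + 1 := ⟨j - 1, by omega⟩
    have h1 := ih j (by omega) (by omega)
    have h2 := I.mul_mem_left (xq n (j + 1)) (ih (j + 1) (by omega) (by omega))
    convert I.add_mem h1 h2 using 1
    rw [Finset.mul_sum, ← Finset.sum_add_distrib]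
    apply Finset.sum_congr rfl
    intro k _
    have hb : Finset.Icc (j + 1) n = insert (j + 1) (Finset.Icc (j + 1 + 1) n) := by
      ext a; simp; omega
    rw [hb, Finset.prod_insert (by simp)]
    ring

theorem sum_xq {n : ℕ} {M : Type*} [AddCommMonoid M] (F : MvPolynomial (Fin n) ℚ → M) :
    ∑ k ∈ Finset.Icc 1 n, F (xq n k) = ∑ i : Fin n, F (X i) := by
  have : Finset.Icc 1 n = (Finset.range n).map (addRightEmbedding 1) := by
    ext a; simp
    constructor
    · intro h; exact ⟨a - 1, by omega, by omega⟩
    · rintro ⟨b, hb, rfl⟩; omega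
  rw [this, Finset.sum_map]
  simp only [addRightEmbedding_apply]
  rw [← Fin.sum_univ_eq_sum_range (fun k => F (xq n (k + 1)))]
  simp only [xq_fin]

theorem psum_mem' (n : ℕ) (I : Ideal (MvPolynomial (Fin n) ℚ))
    (hI : ∀ j ≤ n, fcheck n n j ∈ I) (m : ℕ) (h1 : 1 ≤ m) (hm : m ≤ n) :
    psum (Fin n) ℚ m ∈ I := by
  have := Q_mem n I hI (m - 1) n (by omega) le_rfl
  rw [Nat.sub_add_cancel h1] at this
  simp only [Finset.Icc_eq_empty_of_lt (Nat.lt_succ_self n), Finset.prod_empty, mul_one] at this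
  rw [sum_xq (fun p => p ^ m)] at this
  exact this

theorem esymm_mem' (n : ℕ) (I : Ideal (MvPolynomial (Fin n) ℚ))
    (hI : ∀ m, 1 ≤ m → m ≤ n → psum (Fin n) ℚ m ∈ I) (k : ℕ) (h1 : 1 ≤ k) (hk : k ≤ n) :
    esymm (Fin n) ℚ k ∈ I := by
  have h := mul_esymm_eq_sum (Fin n) ℚ k
  have h2 : (k : MvPolynomial (Fin n) ℚ) * esymm (Fin n) ℚ k ∈ I := by
    rw [h]
    apply I.mul_mem_left
    apply I.sum_mem
    rintro ⟨a, b⟩ hab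
    simp at hab
    apply I.mul_mem_left
    exact hI _ (by simp; omega) (by simp; omega)
  have h3 := I.mul_mem_left (C ((k : ℚ)⁻¹)) h2
  rw [← mul_assoc, ← map_natCast (C : ℚ →+* MvPolynomial (Fin n) ℚ), ← C_mul,
    inv_mul_cancel₀ (by norm_cast; omega), C_1, one_mul] at h3
  exact h3

theorem X_pow_mem (n : ℕ) (I : Ideal (MvPolynomial (Fin n) ℚ))
    (hI : ∀ k, 1 ≤ k → k ≤ n → esymm (Fin n) ℚ k ∈ I) (i : Fin n) :
    (X i : MvPolynomial (Fin n) ℚ) ^ n ∈ I := by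
  have h := Multiset.prod_X_sub_X_eq_sum_esymm
    ((Finset.univ : Finset (Fin n)).val.map (X : Fin n → MvPolynomial (Fin n) ℚ))
  have h2 := congrArg (Polynomial.eval (X i : MvPolynomial (Fin n) ℚ)) h
  rw [Polynomial.eval_multiset_prod, Multiset.prod_eq_zero] at h2
  · simp only [Multiset.card_map, Finset.card_val, Finset.card_univ, Fintype.card_fin,
      Polynomial.eval_finsetSum] at h2
    rw [Finset.sum_range_succ'] at h2
    have e0 : (Multiset.map (X : Fin n → MvPolynomial (Fin n) ℚ) univ.val).esymm 0 = 1 := by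
      simp [Multiset.esymm]
    simp only [Polynomial.eval_mul, Polynomial.eval_pow, Polynomial.eval_neg, Polynomial.eval_one,
      Polynomial.eval_C, Polynomial.eval_X, e0, pow_zero, one_mul, 
      Nat.sub_zero] at h2
    have h3 : (X i : MvPolynomial (Fin n) ℚ) ^ n = - _ := eq_neg_of_add_eq_zero_right h2.symm
    rw [h3]
    apply I.neg_mem
    apply I.sum_mem
    intro k hk
    apply I.mul_mem_left
    apply I.mul_mem_right
    have := hI (k + 1) (by omega) (by simp at hk; omega)
    rwa [MvPolynomial.esymm_eq_multiset_esymm] at this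
  · simp only [Multiset.mem_map]
    refine ⟨Polynomial.X - Polynomial.C (X i), ⟨X i, ⟨i, by simp, rfl⟩, rfl⟩, by simp⟩

theorem fin_quot (n : ℕ) (I : Ideal (MvPolynomial (Fin n) ℚ))
    (hI : ∀ i : Fin n, (X i : MvPolynomial (Fin n) ℚ) ^ n ∈ I) :
    FiniteDimensional ℚ (MvPolynomial (Fin n) ℚ ⧸ I) := by
  have : Algebra.IsIntegral ℚ (MvPolynomial (Fin n) ℚ ⧸ I) := by
    constructor
    intro q
    obtain ⟨p, rfl⟩ := Ideal.Quotient.mk_surjective q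
    induction p using MvPolynomial.induction_on with
    | C a => exact isIntegral_algebraMap (R := ℚ) (x := a)
    | add p q hp hq => rw [map_add]; exact hp.add hq
    | mul_X p i hp =>
      rw [map_mul]
      refine hp.mul ?_
      apply IsIntegral.of_pow (n := n) (Fin.pos i)
      rw [← map_pow, Ideal.Quotient.eq_zero_iff_mem.2 (hI i)]
      exact isIntegral_zero
  exact Algebra.IsIntegral.finite

theorem Id_n (n : ℕ) (h : ℕ → ℕ) (r : ℕ) (hr : r ≤ n) :
    Id n h r n = Ideal.span ((X : Fin n → MvPolynomial (Fin n) ℚ) '' {i | (i : ℕ) < r}) := by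
  unfold Id
  congr 1
  ext p
  simp only [Set.mem_union, Set.mem_image, Set.mem_Icc, Set.mem_ofPred_eq]
  constructor
  · rintro (⟨k, hk, rfl⟩ | ⟨k, hk, rfl⟩)
    · refine ⟨⟨k - 1, by omega⟩, by simp; omega, ?_⟩
      rw [← xq_eq, Nat.sub_add_cancel hk.1]
    · omega
  · rintro ⟨i, hi, rfl⟩
    exact Or.inl ⟨i + 1, by omega, xq_fin i⟩

theorem base_reg (n : ℕ) (h : ℕ → ℕ) (r : ℕ) (hr : r + 1 ≤ n) :
    RegMod (Id n h r n) (xq n (r + 1)) := by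
  rw [Id_n n h r (by omega), xq_eq (by omega)]
  intro g hg
  rw [mem_ideal_span_X_image] at hg ⊢
  intro m hm
  obtain ⟨i, hi, hi'⟩ := hg (Finsupp.single ⟨r, by omega⟩ 1 + m) (by
    rw [mem_support_iff, coeff_X_mul]
    exact mem_support_iff.1 hm)
  refine ⟨i, hi, ?_⟩
  have hi2 : (i : ℕ) < r := hi
  rw [Finsupp.add_apply, Finsupp.single_eq_of_ne, zero_add] at hi'
  · exact hi'
  · rintro rfl; simp at hi2

theorem base_rank (n : ℕ) (h : ℕ → ℕ) :
    Module.finrank ℚ (MvPolynomial (Fin n) ℚ ⧸ Id n h n n) = 1 := by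
  let φ : MvPolynomial (Fin n) ℚ →ₐ[ℚ] ℚ := aeval (fun _ => 0)
  have hker : Id n h n n = RingHom.ker φ := by
    rw [Id_n n h n le_rfl]
    ext p
    rw [mem_ideal_span_X_image, RingHom.mem_ker]
    have : φ p = coeff 0 p := by
      simp [φ, aeval_zero', constantCoeff_eq]
    rw [this]
    constructor
    · intro hp
      by_contra h0
      obtain ⟨i, _, hi⟩ := hp 0 (mem_support_iff.2 h0)
      simp at hi
    · intro h0 m hm
      have hm0 : m ≠ 0 := by
        rintro rfl
        exact mem_support_iff.1 hm h0
      obtain ⟨i, hi⟩ := Finsupp.ne_iff.1 hm0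
      exact ⟨i, i.2, hi⟩
  rw [hker]
  have hs : Function.Surjective φ := fun a => ⟨C a, by simp [φ]⟩
  rw [(Ideal.quotientKerAlgEquivOfSurjective hs).toLinearEquiv.finrank_eq]
  exact Module.finrank_self ℚ

theorem main (n : ℕ) (h : ℕ → ℕ)
    (hH1 : ∀ j : ℕ, 1 ≤ j → j ≤ n → j ≤ h j ∧ h j ≤ n)
    (hH2 : ∀ j : ℕ, 1 ≤ j → j < n → h j ≤ h (j + 1)) :
    FiniteDimensional ℚ (MvPolynomial (Fin n) ℚ ⧸ Id n h 0 0) ∧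
      Module.finrank ℚ (MvPolynomial (Fin n) ℚ ⧸ Id n h 0 0) =
        ∏ j ∈ Finset.Icc 1 n, (h j - j + 1) := by
  have hX : ∀ i, ∀ k : Fin n, (X k : MvPolynomial (Fin n) ℚ) ^ n ∈ Id n h i i := fun i =>
    X_pow_mem n _ (esymm_mem' n _ (psum_mem' n _ (fun j hj =>
      f_mem n h hH1 hH2 i n j hj (fun h1 => (hH1 j h1 hj).2))))
  have hfin : ∀ i, FiniteDimensional ℚ (MvPolynomial (Fin n) ℚ ⧸ Id n h i i) := fun i =>
    fin_quot n _ (hX i)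
  have key : ∀ t i, i + t = n → (∀ r, r < i → RegMod (Id n h r i) (xq n (r + 1))) ∧
      Module.finrank ℚ (MvPolynomial (Fin n) ℚ ⧸ Id n h i i) =
        ∏ j ∈ Finset.Icc (i + 1) n, (h j - j + 1) := by
    intro t
    induction t with
    | zero =>
      rintro i rfl
      refine ⟨fun r hr => base_reg _ h r (by simpa using hr), ?_⟩
      simpa using base_rank i h
    | succ t ih =>
      intro i hi
      obtain ⟨hS, hD⟩ := ih (i + 1) (by omega)
      have hin : i + 1 ≤ n := by omega
      have hA0 : RegMod (Id n h i (i + 1)) (fcheck n (h (i + 1)) (i + 1)) := by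
        apply exchange (hS i (by omega)) n
        rw [← Id_i n h i i hin, xq_eq (by omega)]
        exact hX i _
      have hA : ∀ s r, r + s = i →
          RegMod (Id n h r (i + 1)) (fcheck n (h (i + 1)) (i + 1)) := by
        intro s
        induction s with
        | zero => rintro r rfl; exact hA0
        | succ s ihs =>
          intro r hr
          have h2 := ihs (r + 1) (by omega)
          rw [Id_r] at h2
          exact swap1 (Id_hom _ _ _ _) (xq_hom n (r + 1)) one_pos (hS r (by omega)) h2
      refine ⟨fun r hr => ?_, ?_⟩
      · have h2 := hA (i - (r + 1)) (r + 1) (by omega)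
        rw [Id_r] at h2
        rw [Id_i n h r i hin]
        exact swap2 (hS r (by omega)) h2
      · have f1 := hfin i
        have f2 := hfin (i + 1)
        rw [Id_i n h i i hin] at f1 ⊢
        rw [Id_r] at f2 hD
        rw [dim_exchange (Id_hom _ _ _ _) (fcheck_hom _ _ _) hA0 (xq_hom n (i + 1))
          (hS i (by omega)), hD]
        have hb : Finset.Icc (i + 1) n = insert (i + 1) (Finset.Icc (i + 1 + 1) n) := by
          ext a; simp; omega
        rw [hb, Finset.prod_insert (by simp)]
  exact ⟨hfin 0, (key n 0 (by omega)).2⟩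

end Hess15

/-- For any Hessenberg function `h`, the quotient `ℚ[x_1,…,x_n]/Ǐ(h)` by the ideal
generated by the `f̌_{h(j),j}` is a finite-dimensional `ℚ`-vector space of dimension
`∏_{j=1}^{n} (h(j) - j + 1)`. -/
theorem stmt15 (n : ℕ) (h : ℕ → ℕ)
    (hH1 : ∀ j : ℕ, 1 ≤ j → j ≤ n → j ≤ h j ∧ h j ≤ n)
    (hH2 : ∀ j : ℕ, 1 ≤ j → j < n → h j ≤ h (j + 1)) :
    FiniteDimensional ℚ
        (MvPolynomial (Fin n) ℚ ⧸
          Ideal.span ((fun j => fcheck n (h j) j) '' Set.Icc 1 n)) ∧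
      Module.finrank ℚ
          (MvPolynomial (Fin n) ℚ ⧸
            Ideal.span ((fun j => fcheck n (h j) j) '' Set.Icc 1 n)) =
        ∏ j ∈ Finset.Icc 1 n, (h j - j + 1) := by

  have hI : Hess15.Id n h 0 0 = Ideal.span ((fun j => fcheck n (h j) j) '' Set.Icc 1 n) := by
    simp [Hess15.Id]
  rw [← hI]
  exact Hess15.main n h hH1 hH2
end
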